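/- Let W_1, ..., W_n be entanglement witnesses on a multipartite Hilbert space, W = Σ_{i=1}^n W_i with smallest eigenvalue ε > 0, λ_i the largest eigenvalue of W_i, λ = Σ_i λ_i, and let E = {(η_i, ρ_i)}_{i=1}^n be the ensemble with η_i = Tr(λ_i W − ε W_i)/Tr(λW − εW) and ρ_i = (λ_i W − ε W_i)/Tr(λ_i W − ε W_i). If, for some j ∈ {1,...,n}, W_j is a weakly-optimal entanglement witness (there exists a separable state σ with Tr(σ W_j) = 0), then Q_j(E) = λ_j/(λ − ε). -/

import Mathlib

open ComplexOrder

/-- The product operator `σ 1 ⊗ ⋯ ⊗ σ m` on the multipartite space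
`⨂ k, ℂ^(d k)`, realized as a matrix indexed by tuples. -/
noncomputable def prodMat {m : ℕ} (d : Fin m → ℕ)
    (σ : ∀ k : Fin m, Matrix (Fin (d k)) (Fin (d k)) ℂ) :
    Matrix (∀ k, Fin (d k)) (∀ k, Fin (d k)) ℂ :=
  Matrix.of fun x y => ∏ k, σ k (x k) (y k)

/-- A density matrix: positive semidefinite with unit trace. -/
def IsState {ι : Type*} [Fintype ι] (ρ : Matrix ι ι ℂ) : Prop :=
  ρ.PosSemidef ∧ ρ.trace = 1

/-- A separable operator: a conic combination of product states. -/
def IsSep {m : ℕ} {d : Fin m → ℕ}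
    (E : Matrix (∀ k, Fin (d k)) (∀ k, Fin (d k)) ℂ) : Prop :=
  ∃ (L : ℕ) (p : Fin L → ℝ)
    (σ : Fin L → ∀ k : Fin m, Matrix (Fin (d k)) (Fin (d k)) ℂ),
    (∀ l, 0 ≤ p l) ∧ (∀ l k, IsState (σ l k)) ∧
    E = ∑ l, (p l : ℂ) • prodMat d (σ l)

/-- A block-positive Hermitian operator: `Tr (E * F) ≥ 0` for every separable `F`. -/
def IsBlockPos {m : ℕ} {d : Fin m → ℕ}
    (E : Matrix (∀ k, Fin (d k)) (∀ k, Fin (d k)) ℂ) : Prop :=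
  E.IsHermitian ∧ ∀ F, IsSep F → 0 ≤ (E * F).trace

open scoped MatrixOrder in
theorem Matrix.PosSemidef.exists_eq_conjTranspose_mul_self {ι : Type*} [Fintype ι]
    {A : Matrix ι ι ℂ} (hA : A.PosSemidef) : ∃ B : Matrix ι ι ℂ, A = B.conjTranspose * B := by
  classical
  exact CStarAlgebra.nonneg_iff_eq_star_mul_self.mp hA.nonneg

theorem Matrix.PosSemidef.trace_mul_nonneg {ι : Type*} [Fintype ι]
    {A B : Matrix ι ι ℂ} (hA : A.PosSemidef) (hB : B.PosSemidef) : 0 ≤ (A * B).trace := by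
  obtain ⟨C, rfl⟩ := hB.exists_eq_conjTranspose_mul_self
  rw [← Matrix.mul_assoc, Matrix.trace_mul_comm, ← Matrix.mul_assoc]
  exact (hA.mul_mul_conjTranspose_same C).trace_nonneg

theorem prodMat_conjTranspose_mul_self {m : ℕ} (d : Fin m → ℕ)
    (B : ∀ k : Fin m, Matrix (Fin (d k)) (Fin (d k)) ℂ) :
    prodMat d (fun k => (B k).conjTranspose * B k) =
      (prodMat d B).conjTranspose * prodMat d B := by
  ext x y
  simp only [prodMat, Matrix.of_apply, Matrix.mul_apply, Matrix.conjTranspose_apply,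
    Fintype.prod_sum, star_prod, Finset.prod_mul_distrib]

theorem posSemidef_prodMat {m : ℕ} {d : Fin m → ℕ}
    {σ : ∀ k : Fin m, Matrix (Fin (d k)) (Fin (d k)) ℂ} (hσ : ∀ k, (σ k).PosSemidef) :
    (prodMat d σ).PosSemidef := by
  choose B hB using fun k => (hσ k).exists_eq_conjTranspose_mul_self
  rw [funext hB, prodMat_conjTranspose_mul_self]
  exact Matrix.posSemidef_conjTranspose_mul_self _

theorem IsSep.posSemidef {m : ℕ} {d : Fin m → ℕ}
    {E : Matrix (∀ k, Fin (d k)) (∀ k, Fin (d k)) ℂ} (hE : IsSep E) : E.PosSemidef := by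
  obtain ⟨L, p, σ, hp, hσ, rfl⟩ := hE
  exact Matrix.posSemidef_sum _ fun l _ =>
    (posSemidef_prodMat fun k => (hσ l k).1).smul (by exact_mod_cast hp l)

theorem IsBlockPos.smul {m : ℕ} {d : Fin m → ℕ}
    {E : Matrix (∀ k, Fin (d k)) (∀ k, Fin (d k)) ℂ} (hE : IsBlockPos E) {c : ℝ} (hc : 0 ≤ c) :
    IsBlockPos ((c : ℂ) • E) := by
  refine ⟨hE.1.smul (Complex.conj_ofReal c), fun F hF => ?_⟩
  rw [Matrix.smul_mul, Matrix.trace_smul, smul_eq_mul]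
  exact mul_nonneg (by exact_mod_cast hc) (hE.2 F hF)

/-- A positive semidefinite matrix is recovered from its normalization, even if it is zero. -/
theorem Matrix.PosSemidef.smul_inv_trace_smul {ι : Type*} [Fintype ι]
    {A : Matrix ι ι ℂ} (hA : A.PosSemidef) (D : ℝ) :
    ((A.trace.re / D : ℝ) : ℂ) • A.trace⁻¹ • A = ((D⁻¹ : ℝ) : ℂ) • A := by
  have him : (A.trace.re : ℂ) = A.trace :=
    Complex.ext rfl (by simpa using (Complex.le_def.mp hA.trace_nonneg).2)
  by_cases h : A.trace = 0
  · rw [hA.trace_eq_zero_iff.mp h]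
    simp
  · rw [smul_smul]
    congr 1
    push_cast
    rw [him]
    field_simp

/-- An eigenvalue bound `A ≤ t` dominates the expectation of `A` in a positive operator. -/
theorem trace_mul_re_le_of_posSemidef_sub {ι : Type*} [Fintype ι] [DecidableEq ι]
    {A B : Matrix ι ι ℂ} (hAB : (B - A).PosSemidef) {σ : Matrix ι ι ℂ} (hσ : σ.PosSemidef) :
    (A * σ).trace.re ≤ (B * σ).trace.re := by
  have h := (Complex.le_def.mp (hAB.trace_mul_nonneg hσ)).1
  rw [Matrix.sub_mul, Matrix.trace_sub] at h
  simpa using h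

/-- for the ensemble built from entanglement witnesses `Wf i`, if
`Wf j` is weakly optimal (some separable state `σ` has `Tr(σ * Wf j) = 0`), then
`Q j = λ j / (Λ - ε)`. -/
theorem ensemble_from_EW_family_Q_of_weaklyOptimal
    {m : ℕ} (hm : 2 ≤ m) {d : Fin m → ℕ} (hd : ∀ k, 0 < d k) {n : ℕ}
    (Wf : Fin n → Matrix (∀ k, Fin (d k)) (∀ k, Fin (d k)) ℂ)
    (hEW : ∀ i, IsBlockPos (Wf i) ∧ ¬ (Wf i).PosSemidef)
    (W : Matrix (∀ k, Fin (d k)) (∀ k, Fin (d k)) ℂ) (hW : W = ∑ i, Wf i)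
    (ε : ℝ) (hε : IsGreatest {t : ℝ | (W - (t : ℂ) • 1).PosSemidef} ε) (hεpos : 0 < ε)
    (lam : Fin n → ℝ)
    (hlam : ∀ i, IsLeast {t : ℝ | ((t : ℂ) • 1 - Wf i).PosSemidef} (lam i))
    (lamSum : ℝ) (hlamSum : lamSum = ∑ i, lam i)
    (η : Fin n → ℝ) (ρ : Fin n → Matrix (∀ k, Fin (d k)) (∀ k, Fin (d k)) ℂ)
    (hη : ∀ i, η i = ((lam i : ℂ) • W - (ε : ℂ) • Wf i).trace.re /
        ((lamSum : ℂ) • W - (ε : ℂ) • W).trace.re)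
    (hρ : ∀ i, ρ i = (((lam i : ℂ) • W - (ε : ℂ) • Wf i).trace)⁻¹ •
        ((lam i : ℂ) • W - (ε : ℂ) • Wf i))
    (ρ₀ : Matrix (∀ k, Fin (d k)) (∀ k, Fin (d k)) ℂ)
    (hρ₀ : ρ₀ = ∑ i, (η i : ℂ) • ρ i)
    (j : Fin n)
    (hwo : ∃ σ : Matrix (∀ k, Fin (d k)) (∀ k, Fin (d k)) ℂ,
      IsSep σ ∧ σ.trace = 1 ∧ (σ * Wf j).trace = 0) :
    IsLeast {t : ℝ | IsBlockPos ((t : ℂ) • ρ₀ - (η j : ℂ) • ρ j)}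
      (lam j / (lamSum - ε)) := by
  obtain ⟨σ, hσ, hσ1, hσW⟩ := hwo
  have hσp := hσ.posSemidef
  have hσj : (Wf j * σ).trace = 0 := by rw [Matrix.trace_mul_comm, hσW]
  have : ∀ k, NeZero (d k) := fun k => ⟨(hd k).ne'⟩
  have hWε : (W - (ε : ℂ) • 1).PosSemidef := hε.1
  have hle : ∀ i, ((lam i : ℂ) • 1 - Wf i).PosSemidef := fun i => (hlam i).1
  have hlam0 : ∀ i, 0 ≤ lam i := fun i => by
    have h1 := trace_mul_re_le_of_posSemidef_sub (hle i) hσp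
    have h2 := (Complex.le_def.mp ((hEW i).1.2 σ hσ)).1
    simp only [Matrix.smul_mul, Matrix.one_mul, Matrix.trace_smul, hσ1, smul_eq_mul, mul_one,
      Complex.ofReal_re, Complex.zero_re] at h1 h2
    exact h2.trans h1
  have hWσ : 0 < (W * σ).trace.re := by
    have h1 := trace_mul_re_le_of_posSemidef_sub hWε hσp
    simp only [Matrix.smul_mul, Matrix.one_mul, Matrix.trace_smul, hσ1, smul_eq_mul, mul_one,
      Complex.ofReal_re] at h1
    exact hεpos.trans_le h1
  obtain ⟨N, hNpos, hN⟩ : ∃ N : ℝ, 0 < N ∧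
      (1 : Matrix (∀ k, Fin (d k)) (∀ k, Fin (d k)) ℂ).trace = N :=
    ⟨(Fintype.card (∀ k, Fin (d k)) : ℕ), Nat.cast_pos.mpr Fintype.card_pos, by
      rw [Matrix.trace_one, Complex.ofReal_natCast]⟩
  have htrW : ε * N ≤ W.trace.re := by
    have h := (Complex.le_def.mp hWε.trace_nonneg).1
    simpa [Matrix.trace_sub, Matrix.trace_smul, -Matrix.trace_one, hN] using h
  have htr : ∀ i, (Wf i).trace.re ≤ lam i * N := fun i => by
    have h := (Complex.le_def.mp (hle i).trace_nonneg).1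
    simpa [Matrix.trace_sub, Matrix.trace_smul, -Matrix.trace_one, hN] using h
  have htrj : (Wf j).trace.re < lam j * N := by
    refine (htr j).lt_of_ne fun h => (hEW j).2 ?_
    have h0 : ((lam j : ℂ) • 1 - Wf j).trace = 0 := by
      refine Complex.ext ?_ (Complex.le_def.mp (hle j).trace_nonneg).2.symm
      simp [Matrix.trace_sub, Matrix.trace_smul, -Matrix.trace_one, h, hN]
    rw [← sub_eq_zero.mp ((hle j).trace_eq_zero_iff.mp h0)]
    exact Matrix.PosSemidef.one.smul (by exact_mod_cast hlam0 j)
  have hgap : 0 < lamSum - ε := by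
    have h : W.trace.re < lamSum * N := by
      rw [hW, hlamSum, Matrix.trace_sum, Complex.re_sum, Finset.sum_mul]
      exact Finset.sum_lt_sum (fun i _ => htr i) ⟨j, Finset.mem_univ j, htrj⟩
    exact sub_pos.mpr (lt_of_mul_lt_mul_right (htrW.trans_lt h) hNpos.le)
  set D : ℝ := ((lamSum : ℂ) • W - (ε : ℂ) • W).trace.re with hD
  have hDpos : 0 < D := by
    have h : D = (lamSum - ε) * W.trace.re := by
      simp [hD, Matrix.trace_sub, Matrix.trace_smul, sub_mul]
    rw [h]
    exact mul_pos hgap ((mul_pos hεpos hNpos).trans_le htrW)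
  have hηρ : ∀ i, (η i : ℂ) • ρ i = ((D⁻¹ : ℝ) : ℂ) • ((lam i : ℂ) • W - (ε : ℂ) • Wf i) := by
    intro i
    have hpsd : ((lam i : ℂ) • W - (ε : ℂ) • Wf i).PosSemidef := by
      have h := (hWε.smul (a := (lam i : ℂ)) (by exact_mod_cast hlam0 i)).add
        ((hle i).smul (a := (ε : ℂ)) (by exact_mod_cast hεpos.le))
      convert h using 1
      module
    rw [hη, hρ]
    exact hpsd.smul_inv_trace_smul D
  have hρ₀' : ρ₀ = ((D⁻¹ : ℝ) : ℂ) • ((lamSum : ℂ) - ε) • W := by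
    rw [hρ₀, Finset.sum_congr rfl fun i _ => hηρ i, ← Finset.smul_sum, Finset.sum_sub_distrib,
      ← Finset.sum_smul, ← Finset.smul_sum, ← hW, hlamSum, sub_smul]
    push_cast
    rfl
  have hkey : ∀ t : ℝ, (t : ℂ) • ρ₀ - (η j : ℂ) • ρ j = ((D⁻¹ : ℝ) : ℂ) •
      (((t * (lamSum - ε) - lam j : ℝ) : ℂ) • W + (ε : ℂ) • Wf j) := by
    intro t
    rw [hηρ, hρ₀']
    push_cast
    module
  constructor
  · rw [Set.mem_ofPred_eq, hkey, div_mul_cancel₀ _ hgap.ne', sub_self, Complex.ofReal_zero,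
      zero_smul, zero_add]
    exact ((hEW j).1.smul hεpos.le).smul (inv_nonneg.mpr hDpos.le)
  · intro t ht
    rw [Set.mem_ofPred_eq, hkey] at ht
    have h := (Complex.le_def.mp (ht.2 σ hσ)).1
    rw [Matrix.smul_mul, Matrix.add_mul, Matrix.smul_mul, Matrix.smul_mul, Matrix.trace_smul,
      Matrix.trace_add, Matrix.trace_smul, Matrix.trace_smul, hσj, smul_zero, add_zero,
      smul_eq_mul, smul_eq_mul, Complex.re_ofReal_mul, Complex.re_ofReal_mul,
      Complex.zero_re] at h
    have h' := nonneg_of_mul_nonneg_left (nonneg_of_mul_nonneg_right h (inv_pos.mpr hDpos)) hWσ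
    rw [div_le_iff₀ hgap]
    exact sub_nonneg.mp h'
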